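/- The map Φ̲ : GL(n, ℝ) → GL(n̄, ℝ) defined by Φ̲(A) = A ⊗ₛ A is a well-defined group homomorphism (i.e., A invertible implies A ⊗ₛ A invertible, and Φ̲(AB) = Φ̲(A) Φ̲(B)), and its kernel is exactly {I_n, −I_n}. -/

import Mathlib

open Matrix

noncomputable section

/-- `n̄ = n(n+1)/2`, the dimension of the space of symmetric `n × n` matrices. -/
def triDim (n : ℕ) : ℕ := n * (n + 1) / 2

/-- The (0-based) row/column pair `(r(j), c(j))` of the `j`-th position in the
lexicographic (left-to-right, top-to-bottom) enumeration of the on-or-above-diagonal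
positions of an `n × n` matrix. -/
def rcPair : ℕ → ℕ → ℕ × ℕ
  | 0, _ => (0, 0)
  | (m + 1), j =>
      if j < m + 1 then (0, j)
      else ((rcPair m (j - (m + 1))).1 + 1, (rcPair m (j - (m + 1))).2 + 1)

/-- The orthonormal basis `E_j` of the space of symmetric `n × n` matrices:
`E_j = e_{r(j)} e_{c(j)}ᵀ` if `r(j) = c(j)`, and
`E_j = (√2/2) (e_{r(j)} e_{c(j)}ᵀ + e_{c(j)} e_{r(j)}ᵀ)` if `r(j) < c(j)`. -/
def symBasis (n : ℕ) (j : Fin (triDim n)) : Matrix (Fin n) (Fin n) ℝ :=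
  if (rcPair n j).1 = (rcPair n j).2 then
    Matrix.of fun a b : Fin n =>
      if (a : ℕ) = (rcPair n j).1 ∧ (b : ℕ) = (rcPair n j).2 then (1 : ℝ) else 0
  else
    Matrix.of fun a b : Fin n =>
      if ((a : ℕ) = (rcPair n j).1 ∧ (b : ℕ) = (rcPair n j).2) ∨
          ((a : ℕ) = (rcPair n j).2 ∧ (b : ℕ) = (rcPair n j).1) then
        Real.sqrt 2 / 2
      else 0

/-- Column-stacking vectorization `vec : ℝ^{m×n} → ℝ^{nm}`: `vec(A)_{j·m + i} = A_{i,j}`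
(0-based), realized through `finProdFinEquiv (j, i) = j * m + i`. -/
def mvec {m n : ℕ} (A : Matrix (Fin m) (Fin n) ℝ) : Fin (n * m) → ℝ :=
  fun k => A (finProdFinEquiv.symm k).2 (finProdFinEquiv.symm k).1

/-- The matrix `W_n ∈ ℝ^{n̄ × n²}` whose `j`-th row is `vec(E_j)ᵀ`. -/
def Wmat (n : ℕ) : Matrix (Fin (triDim n)) (Fin (n * n)) ℝ :=
  Matrix.of fun j k => mvec (symBasis n j) k

/-- The Kronecker product on `Fin`-indexed matrices, with the standard flattening
`(A ⊗ B)_{(i·p + k, j·q + l)} = A_{i,j} B_{k,l}`. -/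
def kron {m n p q : ℕ} (A : Matrix (Fin m) (Fin n) ℝ) (B : Matrix (Fin p) (Fin q) ℝ) :
    Matrix (Fin (m * p)) (Fin (n * q)) ℝ :=
  Matrix.reindex finProdFinEquiv finProdFinEquiv (Matrix.kroneckerMap (· * ·) A B)

/-- The symmetric Kronecker product `A ⊗ₛ B = W_m (A ⊗ B) W_nᵀ ∈ ℝ^{m̄ × n̄}`
of rectangular matrices `A, B ∈ ℝ^{m×n}`. -/
def skron {m n : ℕ} (A B : Matrix (Fin m) (Fin n) ℝ) :
    Matrix (Fin (triDim m)) (Fin (triDim n)) ℝ :=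
  Wmat m * kron A B * (Wmat n)ᵀ

/-- The Frobenius inner product `⟨A, B⟩_F = trace(Aᵀ B)`. -/
def frobInner {m n : ℕ} (A B : Matrix (Fin m) (Fin n) ℝ) : ℝ :=
  (Aᵀ * B).trace

/-- Symmetric vectorization `svec(P)_j = ⟨P, E_j⟩_F`. -/
def svec {n : ℕ} (P : Matrix (Fin n) (Fin n) ℝ) : Fin (triDim n) → ℝ :=
  fun j => frobInner P (symBasis n j)

/-- The symmetric part `π(A) = (A + Aᵀ)/2`. -/
def symPart {n : ℕ} (A : Matrix (Fin n) (Fin n) ℝ) : Matrix (Fin n) (Fin n) ℝ :=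
  (1 / 2 : ℝ) • (A + Aᵀ)

/-- The symmetric Kronecker sum `A ⊕ₛ B = A ⊗ₛ I + I ⊗ₛ B`. -/
def skronSum {n : ℕ} (A B : Matrix (Fin n) (Fin n) ℝ) :
    Matrix (Fin (triDim n)) (Fin (triDim n)) ℝ :=
  skron A 1 + skron 1 B

/-- A vector `x ∈ ℝⁿ` regarded as an `n × 1` matrix. -/
def colVec {n : ℕ} (x : Fin n → ℝ) : Matrix (Fin n) (Fin 1) ℝ :=
  Matrix.of fun i _ => x i

open scoped Kronecker

theorem triDim_succ (n : ℕ) : triDim (n + 1) = (n + 1) + triDim n := by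
  unfold triDim
  rw [show (n + 1) * (n + 1 + 1) = n * (n + 1) + (n + 1) * 2 by ring,
    Nat.add_mul_div_right _ _ two_pos, add_comm]

theorem rcPair_le_lt (n j : ℕ) (hj : j < triDim n) :
    (rcPair n j).1 ≤ (rcPair n j).2 ∧ (rcPair n j).2 < n := by
  induction n generalizing j with
  | zero => simp [triDim] at hj
  | succ m ih =>
    rw [triDim_succ] at hj
    by_cases h : j < m + 1
    · simp [rcPair, h]
    · have := ih (j - (m + 1)) (by omega)
      simp only [rcPair, if_neg h]
      omega

theorem rcPair_inj (n i j : ℕ) (hi : i < triDim n) (hj : j < triDim n)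
    (h : rcPair n i = rcPair n j) : i = j := by
  induction n generalizing i j with
  | zero => simp [triDim] at hj
  | succ m ih =>
    rw [triDim_succ] at hi hj
    by_cases h1 : i < m + 1 <;> by_cases h2 : j < m + 1 <;>
      simp only [rcPair, h1, h2, if_true, if_false, Prod.mk.injEq] at h
    · exact h.2
    · omega
    · omega
    · have := ih (i - (m + 1)) (j - (m + 1)) (by omega) (by omega)
        (Prod.ext (by omega) (by omega))
      omega

theorem exists_rcPair_eq (n r c : ℕ) (hrc : r ≤ c) (hc : c < n) :
    ∃ j < triDim n, rcPair n j = (r, c) := by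
  induction n generalizing r c with
  | zero => omega
  | succ m ih =>
    rw [triDim_succ]
    rcases r with _ | r
    · exact ⟨c, by omega, by simp [rcPair, hc]⟩
    · obtain ⟨c, rfl⟩ : ∃ d, c = d + 1 := ⟨c - 1, by omega⟩
      obtain ⟨j, hj, h⟩ := ih r c (by omega) (by omega)
      exact ⟨j + (m + 1), by omega, by
        rw [rcPair, if_neg (by omega), Nat.add_sub_cancel, h]⟩

/-- The nonzero entry of the basis matrices at position `(a, b)`. -/
def symWeight {n : ℕ} (a b : Fin n) : ℝ := if a = b then 1 else √2 / 2

theorem symWeight_comm {n : ℕ} (a b : Fin n) : symWeight a b = symWeight b a := by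
  simp [symWeight, eq_comm]

theorem symWeight_sq {n : ℕ} (a b : Fin n) :
    symWeight a b * symWeight a b = if a = b then 1 else 1 / 2 := by
  unfold symWeight
  split_ifs
  · norm_num
  · have := Real.mul_self_sqrt (show (0 : ℝ) ≤ 2 by norm_num)
    linarith

/-- Each position `(a, b)` belongs to the support of exactly one basis matrix, and two positions
share a basis matrix exactly when they agree up to transposition. -/
theorem exists_symBasis_index (n : ℕ) :
    ∃ idx : Fin n × Fin n → Fin (triDim n),
      (∀ j a b, symBasis n j a b = if j = idx (a, b) then symWeight a b else 0) ∧
      (∀ p q, idx p = idx q ↔ p = q ∨ p = q.swap) ∧ Function.Surjective idx := by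
  have hex : ∀ p : Fin n × Fin n, ∃ j : Fin (triDim n),
      rcPair n j = (min (p.1 : ℕ) p.2, max (p.1 : ℕ) p.2) := fun p ↦ by
    obtain ⟨j, hj, h⟩ := exists_rcPair_eq n (min (p.1 : ℕ) p.2) (max (p.1 : ℕ) p.2)
      (by omega) (by omega)
    exact ⟨⟨j, hj⟩, h⟩
  choose idx hidx using hex
  have key : ∀ (j : Fin (triDim n)) p, j = idx p ↔
      (rcPair n j).1 = min (p.1 : ℕ) p.2 ∧ (rcPair n j).2 = max (p.1 : ℕ) p.2 := by
    intro j p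
    rw [← Prod.mk.injEq, Prod.mk.eta, ← hidx]
    exact ⟨fun h ↦ by rw [h], fun h ↦ Fin.ext (rcPair_inj n _ _ j.2 (idx p).2 h)⟩
  refine ⟨idx, fun j a b ↦ ?_, fun p q ↦ ?_, fun j ↦ ?_⟩
  · have hle := (rcPair_le_lt n j j.2).1
    simp only [key, symBasis, symWeight, Fin.ext_iff]
    split_ifs <;> simp only [Matrix.of_apply] <;> split_ifs <;> first | rfl | omega
  · rw [key, hidx]
    simp only [Prod.ext_iff, Fin.ext_iff, Prod.fst_swap, Prod.snd_swap]
    omega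
  · obtain ⟨hle, hlt⟩ := rcPair_le_lt n j j.2
    refine ⟨(⟨(rcPair n j).1, by omega⟩, ⟨(rcPair n j).2, hlt⟩), ?_⟩
    rw [eq_comm, key]
    simp [hle]

/-- The matrix `W_n` with its columns indexed by pairs. -/
def pairWmat (n : ℕ) : Matrix (Fin (triDim n)) (Fin n × Fin n) ℝ :=
  Matrix.of fun j p => symBasis n j p.2 p.1

theorem skron_eq_pairWmat {n : ℕ} (A B : Matrix (Fin n) (Fin n) ℝ) :
    skron A B = pairWmat n * (A ⊗ₖ B) * (pairWmat n)ᵀ := by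
  have hW : Wmat n = (pairWmat n).submatrix id finProdFinEquiv.symm := rfl
  have hK : kron A B = (A ⊗ₖ B).submatrix finProdFinEquiv.symm finProdFinEquiv.symm := rfl
  rw [skron, hW, hK, transpose_submatrix, submatrix_mul_equiv, submatrix_mul_equiv,
    submatrix_id_id]

theorem pairWmat_mul_transpose (n : ℕ) : pairWmat n * (pairWmat n)ᵀ = 1 := by
  obtain ⟨idx, hE, hidx, hsurj⟩ := exists_symBasis_index n
  ext j k
  obtain ⟨⟨r, c⟩, rfl⟩ := hsurj j
  have hterm : ∀ p : Fin n × Fin n, pairWmat n (idx (r, c)) p * (pairWmat n)ᵀ p k =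
      if idx (r, c) = k then
        if p = (r, c) ∨ p = (c, r) then symWeight r c * symWeight r c else 0
      else 0 := by
    rintro ⟨a, b⟩
    have h1 : idx (r, c) = idx (b, a) ↔ (a, b) = (r, c) ∨ (a, b) = (c, r) := by
      rw [hidx]; simp only [Prod.mk.injEq, Prod.swap_prod_mk]; grind
    simp only [pairWmat, Matrix.of_apply, Matrix.transpose_apply, hE, ← h1]
    by_cases h : idx (r, c) = idx (b, a)
    · have hw : symWeight b a = symWeight r c := by
        rcases (hidx _ _).1 h with h | h <;>
          simp only [Prod.mk.injEq, Prod.swap_prod_mk] at h <;> obtain ⟨rfl, rfl⟩ := h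
        · rfl
        · exact symWeight_comm _ _
      simp [h, hw, eq_comm]
    · simp [h]
  rw [Matrix.mul_apply, Finset.sum_congr rfl fun p _ ↦ hterm p, Matrix.one_apply]
  split_ifs with h
  · rw [← Finset.sum_filter, Finset.sum_const, symWeight_sq,
      show Finset.univ.filter (fun p : Fin n × Fin n ↦ p = (r, c) ∨ p = (c, r)) =
        {(r, c), (c, r)} by ext; simp]
    by_cases hrc : r = c
    · simp [hrc]
    · rw [Finset.card_pair (by simp [hrc])]
      simp [hrc]
  · simp

/-- `W_nᵀ W_n` is the projection onto the symmetric matrices. -/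
theorem pairWmat_transpose_mul_apply {n : ℕ} (p q : Fin n × Fin n) :
    ((pairWmat n)ᵀ * pairWmat n) p q =
      ((if p = q then 1 else 0) + (if p = q.swap then 1 else 0)) / 2 := by
  obtain ⟨idx, hE, hidx, -⟩ := exists_symBasis_index n
  obtain ⟨a, b⟩ := p
  obtain ⟨c, d⟩ := q
  simp only [Matrix.mul_apply, pairWmat, Matrix.of_apply, Matrix.transpose_apply, hE, ite_mul,
    zero_mul, Finset.sum_ite_eq', Finset.mem_univ, if_true, hidx]
  have hsq := symWeight_sq b a
  have hcomm := symWeight_comm a b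
  simp only [Prod.mk.injEq, Prod.swap_prod_mk]
  grind

theorem mul_pairWmat_proj_apply {n : ℕ} (M : Matrix (Fin n × Fin n) (Fin n × Fin n) ℝ)
    (p q : Fin n × Fin n) :
    (M * ((pairWmat n)ᵀ * pairWmat n)) p q = (M p q + M p q.swap) / 2 := by
  rw [Matrix.mul_apply]
  simp_rw [pairWmat_transpose_mul_apply, mul_div_assoc', mul_add, mul_ite, mul_one, mul_zero]
  rw [← Finset.sum_div, Finset.sum_add_distrib]
  simp

theorem pairWmat_proj_mul_apply {n : ℕ} (M : Matrix (Fin n × Fin n) (Fin n × Fin n) ℝ)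
    (p q : Fin n × Fin n) :
    (((pairWmat n)ᵀ * pairWmat n) * M) p q = (M p q + M p.swap q) / 2 := by
  have hswap : ∀ x : Fin n × Fin n, p = x.swap ↔ p.swap = x := fun x ↦
    ⟨fun h ↦ by simp [h], fun h ↦ by simp [← h]⟩
  rw [Matrix.mul_apply]
  simp_rw [pairWmat_transpose_mul_apply, div_mul_eq_mul_div, add_mul, ite_mul, one_mul, zero_mul,
    hswap]
  rw [← Finset.sum_div, Finset.sum_add_distrib]
  simp

theorem pairWmat_proj_comm_kronecker_self {n : ℕ} (A : Matrix (Fin n) (Fin n) ℝ) :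
    ((pairWmat n)ᵀ * pairWmat n) * (A ⊗ₖ A) = (A ⊗ₖ A) * ((pairWmat n)ᵀ * pairWmat n) := by
  ext ⟨a, b⟩ ⟨c, d⟩
  simp only [pairWmat_proj_mul_apply, mul_pairWmat_proj_apply, kroneckerMap_apply,
    Prod.swap_prod_mk]
  ring

theorem skron_self_mul {n : ℕ} (A B : Matrix (Fin n) (Fin n) ℝ) :
    skron (A * B) (A * B) = skron A A * skron B B := by
  have hW := pairWmat_mul_transpose n
  have hc := pairWmat_proj_comm_kronecker_self A
  simp only [skron_eq_pairWmat]
  rw [mul_kronecker_mul]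
  calc pairWmat n * (A ⊗ₖ A * B ⊗ₖ B) * (pairWmat n)ᵀ
      = (pairWmat n * (pairWmat n)ᵀ) * pairWmat n * (A ⊗ₖ A * B ⊗ₖ B) * (pairWmat n)ᵀ := by
        rw [hW, Matrix.one_mul]
    _ = pairWmat n * (((pairWmat n)ᵀ * pairWmat n) * A ⊗ₖ A) * B ⊗ₖ B * (pairWmat n)ᵀ := by
        simp only [Matrix.mul_assoc]
    _ = _ := by
        rw [hc]
        simp only [Matrix.mul_assoc]

theorem skron_one_one (n : ℕ) : skron (1 : Matrix (Fin n) (Fin n) ℝ) 1 = 1 := by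
  rw [skron_eq_pairWmat, one_kronecker_one, Matrix.mul_one, pairWmat_mul_transpose]

theorem skron_neg_neg {n : ℕ} (A B : Matrix (Fin n) (Fin n) ℝ) :
    skron (-A) (-B) = skron A B := by
  have h : (-A) ⊗ₖ (-B) = A ⊗ₖ B := by
    ext
    simp
  rw [skron_eq_pairWmat, skron_eq_pairWmat, h]

theorem mul_add_mul_of_skron_self_eq_one {n : ℕ} {A : Matrix (Fin n) (Fin n) ℝ}
    (h : skron A A = 1) (a b c d : Fin n) :
    A a c * A b d + A a d * A b c =
      (if (a, b) = (c, d) then 1 else 0) + (if (a, b) = (d, c) then 1 else 0) := by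
  have hW := pairWmat_mul_transpose n
  have hc := pairWmat_proj_comm_kronecker_self A
  rw [skron_eq_pairWmat] at h
  have hP : A ⊗ₖ A * ((pairWmat n)ᵀ * pairWmat n) = (pairWmat n)ᵀ * pairWmat n :=
    calc A ⊗ₖ A * ((pairWmat n)ᵀ * pairWmat n)
        = A ⊗ₖ A * ((pairWmat n)ᵀ * (pairWmat n * (pairWmat n)ᵀ) * pairWmat n) := by
          rw [hW, Matrix.mul_one]
      _ = (A ⊗ₖ A * ((pairWmat n)ᵀ * pairWmat n)) * (pairWmat n)ᵀ * pairWmat n := by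
          simp only [Matrix.mul_assoc]
      _ = (pairWmat n)ᵀ * (pairWmat n * A ⊗ₖ A * (pairWmat n)ᵀ) * pairWmat n := by
          rw [← hc]
          simp only [Matrix.mul_assoc]
      _ = _ := by rw [h, Matrix.mul_one]
  have := congrFun (congrFun hP (a, b)) (c, d)
  rw [mul_pairWmat_proj_apply, pairWmat_transpose_mul_apply] at this
  simp only [kroneckerMap_apply, Prod.swap_prod_mk] at this
  linarith

theorem eq_one_or_eq_neg_one_of_skron_self_eq_one {n : ℕ} {A : Matrix (Fin n) (Fin n) ℝ}
    (h : skron A A = 1) : A = 1 ∨ A = -1 := by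
  have key := mul_add_mul_of_skron_self_eq_one h
  have hoff : ∀ a c, a ≠ c → A a c = 0 := fun a c hac ↦ by
    have := key a a c c
    simp only [Prod.mk.injEq, hac, false_and, if_false] at this
    exact mul_self_eq_zero.1 (by linarith)
  have hdiag : ∀ a, A a a = 1 ∨ A a a = -1 := fun a ↦ by
    have := key a a a a
    simp only [if_true] at this
    exact mul_self_eq_one_iff.1 (by linarith)
  have hmul : ∀ a b, A a a * A b b = 1 := fun a b ↦ by
    by_cases hab : a = b
    · subst hab
      exact mul_self_eq_one_iff.2 (hdiag a)
    · have := key a b a b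
      rw [hoff a b hab] at this
      simpa [hab] using this
  by_cases hall : ∀ a, A a a = 1
  · left
    ext a c
    by_cases hac : a = c
    · subst hac
      simp [hall]
    · simp [hoff a c hac, hac]
  · right
    push Not at hall
    obtain ⟨b, hb⟩ := hall
    have hb' := (hdiag b).resolve_left hb
    ext a c
    by_cases hac : a = c
    · subst hac
      have := hmul a b
      rw [hb'] at this
      simp only [Matrix.neg_apply, Matrix.one_apply_eq]
      linarith
    · simp [hoff a c hac, hac]

/-- `Φ̲(A) = A ⊗ₛ A` is a well-defined group homomorphism
`GL(n,ℝ) → GL(n̄,ℝ)` whose kernel is exactly `{I, -I}`. -/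
theorem skron_sq_group_hom (n : ℕ) :
    (∀ A : Matrix (Fin n) (Fin n) ℝ, IsUnit A → IsUnit (skron A A)) ∧
    (∀ A B : Matrix (Fin n) (Fin n) ℝ, IsUnit A → IsUnit B →
      skron (A * B) (A * B) = skron A A * skron B B) ∧
    (∀ A : Matrix (Fin n) (Fin n) ℝ, IsUnit A →
      (skron A A = 1 ↔ A = 1 ∨ A = -1)) := by
  refine ⟨fun A hA ↦ ?_, fun A B _ _ ↦ skron_self_mul A B,
    fun A _ ↦ ⟨eq_one_or_eq_neg_one_of_skron_self_eq_one, ?_⟩⟩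
  · obtain ⟨B, hB⟩ := hA.exists_right_inv
    exact IsUnit.of_mul_eq_one _ (by rw [← skron_self_mul, hB, skron_one_one])
  · rintro (rfl | rfl)
    · exact skron_one_one n
    · rw [skron_neg_neg, skron_one_one]
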